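/- arXiv:2512.05553 — 5 statements merged into one kernel-verified Lean document; each statement's English description precedes it below -/
import Mathlib

section
/- Decomposition of the Euler equation (equations (2.7)–(2.8)/(Euler-0**)–(Euler-i**)): Let L be a Lie algebra over ℝ, n ∈ ℕ, and let p₀, …, pₙ be linear subspaces (submodules) of L such that ⁅p_i, p_j⁆ ⊆ p_j whenever 0 ≤ i < j ≤ n. Let s₀, …, sₙ ∈ ℝ and x₀, …, xₙ ∈ L with x_i ∈ p_i for each i. Then ⁅ ∑_{i=0}^{n} x_i, ∑_{j=0}^{n} s_j·x_j ⁆ = ∑_{j=1}^{n} ⁅ ∑_{i=0}^{j−1} (s_j − s_i)·x_i, x_j ⁆, and for each j ∈ {1,…,n} the summand ⁅ ∑_{i<j} (s_j − s_i)·x_i, x_j ⁆ belongs to p_j. In particular the right-hand side has no component in p₀, so x₀ is a first integral of the Euler equation ẋ = ⁅x, ∑ s_j x_j⁆. -/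
/-!
Decomposition of the Euler equation (equations (2.7)–(2.8)): for subspaces
`p₀, …, pₙ` of a real Lie algebra `L` with `⁅p_i, p_j⁆ ⊆ p_j` for `i < j ≤ n`,
and `x_i ∈ p_i`, one has
`⁅∑ x_i, ∑ s_j • x_j⁆ = ∑_{j=1}^{n} ⁅∑_{i<j} (s_j - s_i) • x_i, x_j⁆`,
where the `j`-th summand lies in `p_j`.
-/

/-- The bracket of `∑ x_i` with `∑ s_j • x_j`, collected by the larger index. -/
theorem lie_sum_sum_smul_eq_sum_Icc {R L : Type*} [CommRing R] [LieRing L] [LieAlgebra R L]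
    (s : ℕ → R) (x : ℕ → L) (n : ℕ) :
    ⁅∑ i ∈ Finset.range (n + 1), x i, ∑ j ∈ Finset.range (n + 1), s j • x j⁆ =
      ∑ j ∈ Finset.Icc 1 n, ⁅∑ i ∈ Finset.range j, (s j - s i) • x i, x j⁆ := by
  induction n with
  | zero => simp
  | succ n ih =>
    rw [Finset.sum_range_succ x, Finset.sum_range_succ (fun j => s j • x j),
      Finset.sum_Icc_succ_top (by omega), ← ih]
    simp only [sub_smul, Finset.sum_sub_distrib, ← Finset.smul_sum, add_lie, lie_add, sub_lie,
      smul_lie, lie_smul, lie_self, add_zero]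
    rw [← lie_skew (x (n + 1))]
    abel

theorem euler_decomposition (L : Type*) [LieRing L] [LieAlgebra ℝ L] (n : ℕ)
    (p : ℕ → Submodule ℝ L)
    (hp : ∀ i j : ℕ, i < j → j ≤ n → ∀ u ∈ p i, ∀ v ∈ p j, ⁅u, v⁆ ∈ p j)
    (s : ℕ → ℝ) (x : ℕ → L) (hx : ∀ i : ℕ, i ≤ n → x i ∈ p i) :
    ⁅∑ i ∈ Finset.range (n + 1), x i, ∑ j ∈ Finset.range (n + 1), s j • x j⁆ =
      ∑ j ∈ Finset.Icc 1 n, ⁅∑ i ∈ Finset.range j, (s j - s i) • x i, x j⁆ ∧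
    ∀ j : ℕ, 1 ≤ j → j ≤ n →
      ⁅∑ i ∈ Finset.range j, (s j - s i) • x i, x j⁆ ∈ p j := by
  refine ⟨lie_sum_sum_smul_eq_sum_Icc s x n, fun j _ hj => ?_⟩
  rw [sum_lie]
  refine Submodule.sum_mem _ fun i hi => ?_
  have hij : i < j := Finset.mem_range.mp hi
  exact hp i j hij hj _ (Submodule.smul_mem _ _ (hx i (hij.le.trans hj))) _ (hx j hj)
end

section
/- Recursion formulas in the proof of Lemma 4.1: Fix n ≥ 3 and in Mₙ(ℝ) set e_{ij} = E_{ij} − E_{ji}, v₁ = ∑_{k=2}^{n−1} e_{k,k+1}, v₂ = e_{12}, v₃ = ⁅v₁, v₂⁆, and v_j = v_{j−2} + ⁅v₁, v_{j−1}⁆ for 4 ≤ j ≤ n. Then e_{1j} = (−1)^j v_j for every 2 ≤ j ≤ n, and e_{ij} = (−1)^{i+j} ⁅v_j, v_i⁆ for every 1 < i < j ≤ n. -/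
/-!
Recursion formulas in the proof of Lemma 4.1: with `e_{ij} = E_{ij} - E_{ji}`
(1-based indexing), `v₁ = ∑_{k=2}^{n-1} e_{k,k+1}`, `v₂ = e_{12}`,
`v₃ = ⁅v₁, v₂⁆` and `v_j = v_{j-2} + ⁅v₁, v_{j-1}⁆` for `4 ≤ j ≤ n`, one has
`e_{1j} = (-1)^j v_j` for `2 ≤ j ≤ n` and `e_{ij} = (-1)^{i+j} ⁅v_j, v_i⁆`
for `1 < i < j ≤ n`.
-/

open Matrix

/-- The standard matrix unit `E_{ij}` in `1`-based indexing (zero if an index is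
out of range). -/
def stdE (n : ℕ) (i j : ℕ) : Matrix (Fin n) (Fin n) ℝ :=
  Matrix.of fun a b : Fin n =>
    if (a : ℕ) + 1 = i ∧ (b : ℕ) + 1 = j then (1 : ℝ) else 0

/-- `e_{ij} = E_{ij} - E_{ji}` in `1`-based indexing. -/
def eMat (n : ℕ) (i j : ℕ) : Matrix (Fin n) (Fin n) ℝ :=
  stdE n i j - stdE n j i

/-- The sequence `v₁ = ∑_{k=2}^{n-1} e_{k,k+1}`, `v₂ = e_{12}`, `v₃ = ⁅v₁, v₂⁆`,
`v_j = v_{j-2} + ⁅v₁, v_{j-1}⁆` for `j ≥ 4` (and `v₀ = 0` for definiteness). -/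
def vseq (n : ℕ) : ℕ → Matrix (Fin n) (Fin n) ℝ
  | 0 => 0
  | 1 => ∑ k ∈ Finset.Icc 2 (n - 1), eMat n k (k + 1)
  | 2 => eMat n 1 2
  | 3 => ⁅vseq n 1, vseq n 2⁆
  | (j + 4) => vseq n (j + 2) + ⁅vseq n 1, vseq n (j + 3)⁆

theorem stdE_mul_stdE {n j : ℕ} (h1 : 1 ≤ j) (hjn : j ≤ n) (i k l : ℕ) :
    stdE n i j * stdE n k l = if j = k then stdE n i l else 0 := by
  ext a b
  rw [Matrix.mul_apply, Finset.sum_eq_single (⟨j - 1, by omega⟩ : Fin n)]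
  · have hj : j - 1 + 1 = j := by omega
    by_cases hjk : j = k
    · subst hjk
      simp [stdE, hj, ← ite_and, and_comm]
    · simp [stdE, hj, hjk]
  · intro c _ hc
    have hc' : (c : ℕ) + 1 ≠ j := fun h => hc (Fin.ext (by simp only; omega))
    simp [stdE, hc']
  · simp

theorem eMat_swap (n i j : ℕ) : eMat n i j = -eMat n j i := by
  simp [eMat]

/-- The structure relations of `𝔰𝔬(n)` in the standard basis. -/
theorem lie_eMat_eMat {n i j k l : ℕ} (hi : 1 ≤ i ∧ i ≤ n) (hj : 1 ≤ j ∧ j ≤ n)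
    (hk : 1 ≤ k ∧ k ≤ n) (hl : 1 ≤ l ∧ l ≤ n) :
    ⁅eMat n i j, eMat n k l⁆ =
      (if j = k then eMat n i l else 0) - (if i = k then eMat n j l else 0)
        + (if i = l then eMat n j k else 0) - (if j = l then eMat n i k else 0) := by
  simp only [Ring.lie_def, eMat, sub_mul, mul_sub, stdE_mul_stdE hi.1 hi.2,
    stdE_mul_stdE hj.1 hj.2, stdE_mul_stdE hk.1 hk.2, stdE_mul_stdE hl.1 hl.2,
    eq_comm (a := k), eq_comm (a := l)]
  split_ifs <;> abel

theorem lie_vseq_one_eMat {n m : ℕ} (h2 : 2 ≤ m) (hm : m + 1 ≤ n) :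
    ⁅vseq n 1, eMat n 1 m⁆ =
      (if 3 ≤ m then eMat n 1 (m - 1) else 0) - eMat n 1 (m + 1) := by
  have hterm : ∀ k ∈ Finset.Icc 2 (n - 1), ⁅eMat n k (k + 1), eMat n 1 m⁆ =
      (if k = m - 1 then eMat n 1 (m - 1) else 0)
        - (if k = m then eMat n 1 (m + 1) else 0) := by
    intro k hk
    rw [Finset.mem_Icc] at hk
    rw [lie_eMat_eMat (by omega) (by omega) (by omega) (by omega),
      if_neg (by omega), if_neg (by omega), eMat_swap n (k + 1) 1, eMat_swap n k 1]
    split_ifs <;> first | omega | (subst_vars; simp)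
  rw [vseq, LieRing.of_associative_ring_bracket, Finset.sum_mul, Finset.mul_sum,
    ← Finset.sum_sub_distrib]
  simp only [← LieRing.of_associative_ring_bracket]
  rw [Finset.sum_congr rfl hterm, Finset.sum_sub_distrib, Finset.sum_ite_eq',
    Finset.sum_ite_eq', if_pos (Finset.mem_Icc.2 (by omega : 2 ≤ m ∧ m ≤ n - 1))]
  congr 1
  exact if_congr (by rw [Finset.mem_Icc]; omega) rfl rfl

theorem vseq_eq_smul_eMat (n : ℕ) :
    ∀ j : ℕ, 2 ≤ j → j ≤ n → vseq n j = (-1 : ℝ) ^ j • eMat n 1 j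
  | 0, h, _ => by omega
  | 1, h, _ => by omega
  | 2, _, _ => by simp [vseq]
  | 3, _, h => by
    rw [vseq, show vseq n 2 = eMat n 1 2 by rw [vseq], lie_vseq_one_eMat le_rfl h]
    norm_num [pow_succ]
  | j + 4, _, h => by
    rw [vseq, vseq_eq_smul_eMat n (j + 2) (by omega) (by omega),
      vseq_eq_smul_eMat n (j + 3) (by omega) (by omega), Ring.lie_def,
      mul_smul_comm, smul_mul_assoc, ← smul_sub, ← Ring.lie_def, lie_vseq_one_eMat (by omega) h, if_pos (by omega)]
    simp only [show j + 3 - 1 = j + 2 by omega, add_assoc, pow_add]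
    norm_num
    module

/-- Recursion formulas in the proof of Lemma 4.1. -/
theorem vseq_recursion (n : ℕ) (hn : 3 ≤ n) :
    (∀ j : ℕ, 2 ≤ j → j ≤ n → eMat n 1 j = (-1 : ℝ) ^ j • vseq n j) ∧
    (∀ i j : ℕ, 1 < i → i < j → j ≤ n →
      eMat n i j = (-1 : ℝ) ^ (i + j) • ⁅vseq n j, vseq n i⁆) := by
  have hv := vseq_eq_smul_eMat n
  refine ⟨fun j h2 hj => ?_, fun i j hi hij hj => ?_⟩
  · rw [hv j h2 hj, smul_smul, ← mul_pow]
    simp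
  · rw [hv j (by omega) hj, hv i hi (by omega), Ring.lie_def, smul_mul_smul_comm,
      smul_mul_smul_comm, ← pow_add, ← pow_add, add_comm j i, ← smul_sub, ← Ring.lie_def, smul_smul,
      ← pow_add, ← two_mul (i + j), pow_mul,
      lie_eMat_eMat (by omega) (by omega) (by omega) (by omega), if_neg (by omega),
      if_pos rfl, if_neg (by omega), if_neg (by omega), eMat_swap n i j]
    simp
end

section
/- First integrals of the reduced system (4.3): Let ν₁ ∈ ℝ and let x₂₃, x₂₄, x₃₄ : ℝ → ℝ be differentiable functions satisfying, for all t: x₂₃′ = −ν₁ x₂₄(x₂₃+x₃₄); x₂₄′ = ν₁(x₂₃−x₃₄)(x₂₃+x₃₄); x₃₄′ = ν₁ x₂₄(x₂₃+x₃₄). Then the functions t ↦ x₂₃(t)+x₃₄(t) and t ↦ (x₂₃(t)−x₃₄(t))² + 2·x₂₄(t)² are constant on ℝ; i.e., every solution curve lies on the intersection of a plane x₂₃+x₃₄ = c₂ with a cylinder (x₂₃−x₃₄)² + 2x₂₄² = c₁. -/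
/-!
First integrals of the reduced system (4.3): along any solution of
`x₂₃' = -ν₁ x₂₄ (x₂₃ + x₃₄)`, `x₂₄' = ν₁ (x₂₃ - x₃₄)(x₂₃ + x₃₄)`,
`x₃₄' = ν₁ x₂₄ (x₂₃ + x₃₄)`, the functions `x₂₃ + x₃₄` and
`(x₂₃ - x₃₄)² + 2 x₂₄²` are constant.
-/

/-- A real function whose derivative vanishes everywhere is constant. -/
theorem eq_of_forall_hasDerivAt_zero {f : ℝ → ℝ} (hf : ∀ t, HasDerivAt f 0 t) (s t : ℝ) :
    f s = f t :=
  is_const_of_deriv_eq_zero (fun u => (hf u).differentiableAt) (fun u => (hf u).deriv) s t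

theorem reduced_system_first_integrals (ν₁ : ℝ)
    (x₂₃ x₂₄ x₃₄ : ℝ → ℝ)
    (h₂₃ : ∀ t : ℝ, HasDerivAt x₂₃ (-ν₁ * x₂₄ t * (x₂₃ t + x₃₄ t)) t)
    (h₂₄ : ∀ t : ℝ, HasDerivAt x₂₄ (ν₁ * (x₂₃ t - x₃₄ t) * (x₂₃ t + x₃₄ t)) t)
    (h₃₄ : ∀ t : ℝ, HasDerivAt x₃₄ (ν₁ * x₂₄ t * (x₂₃ t + x₃₄ t)) t) :
    (∀ t : ℝ, x₂₃ t + x₃₄ t = x₂₃ 0 + x₃₄ 0) ∧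
    (∀ t : ℝ, (x₂₃ t - x₃₄ t) ^ 2 + 2 * (x₂₄ t) ^ 2 =
      (x₂₃ 0 - x₃₄ 0) ^ 2 + 2 * (x₂₄ 0) ^ 2) := by
  constructor
  · intro t
    refine eq_of_forall_hasDerivAt_zero (f := fun u => x₂₃ u + x₃₄ u) (fun u => ?_) t 0
    exact ((h₂₃ u).fun_add (h₃₄ u)).congr_deriv (by ring)
  · intro t
    refine eq_of_forall_hasDerivAt_zero
      (f := fun u => (x₂₃ u - x₃₄ u) ^ 2 + 2 * (x₂₄ u) ^ 2) (fun u => ?_) t 0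
    exact ((((h₂₃ u).fun_sub (h₃₄ u)).fun_pow 2).fun_add
      (((h₂₄ u).fun_pow 2).const_mul 2)).congr_deriv (by push_cast; ring)
end

section
/- Lax identity for the Manakov operator (5.1): Let n ∈ ℕ, let a, b : Fin n → ℝ with a injective (aᵢ ≠ aⱼ for i ≠ j), and let A = diag(a), B = diag(b) ∈ Mₙ(ℝ). Let x ∈ Mₙ(ℝ) be skew-symmetric and define ω ∈ Mₙ(ℝ) by ω_{ij} = ((bᵢ − bⱼ)/(aᵢ − aⱼ))·x_{ij} for i ≠ j and ω_{ii} = 0. Then ⁅A, ω⁆ = ⁅B, x⁆, and consequently for every λ ∈ ℝ one has ⁅x + λ·A, ω + λ·B⁆ = ⁅x, ω⁆. -/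
/-!
Lax identity for the Manakov operator (5.1): with `A = diag a`, `B = diag b`
(`a` injective), `x` skew-symmetric, and
`ω_{ij} = ((bᵢ - bⱼ)/(aᵢ - aⱼ)) x_{ij}` for `i ≠ j`, `ω_{ii} = 0`, one has
`⁅A, ω⁆ = ⁅B, x⁆` and hence `⁅x + λA, ω + λB⁆ = ⁅x, ω⁆` for every `λ ∈ ℝ`.
-/

open Matrix

/-- The Manakov angular velocity `ω = ad_A⁻¹ ∘ ad_B (x)`:
`ω_{ij} = ((bᵢ - bⱼ)/(aᵢ - aⱼ)) x_{ij}` for `i ≠ j`, and `ω_{ii} = 0`. -/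
noncomputable def manakovOmega {n : ℕ} (a b : Fin n → ℝ) (x : Matrix (Fin n) (Fin n) ℝ) :
    Matrix (Fin n) (Fin n) ℝ :=
  Matrix.of fun i j => if i = j then 0 else ((b i - b j) / (a i - a j)) * x i j

theorem lie_diagonal_apply {n : ℕ} (d : Fin n → ℝ) (y : Matrix (Fin n) (Fin n) ℝ)
    (i j : Fin n) : ⁅Matrix.diagonal d, y⁆ i j = (d i - d j) * y i j := by
  rw [Ring.lie_def, Matrix.sub_apply, Matrix.diagonal_mul, Matrix.mul_diagonal]
  ring

theorem lie_diagonal_manakovOmega {n : ℕ} (a b : Fin n → ℝ) (ha : Function.Injective a)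
    (x : Matrix (Fin n) (Fin n) ℝ) :
    ⁅Matrix.diagonal a, manakovOmega a b x⁆ = ⁅Matrix.diagonal b, x⁆ := by
  ext i j
  rw [lie_diagonal_apply, lie_diagonal_apply]
  by_cases hij : i = j
  · simp [hij]
  · have hne : a i - a j ≠ 0 := sub_ne_zero.mpr (ha.ne hij)
    simp only [manakovOmega, Matrix.of_apply, if_neg hij]
    field_simp

theorem lie_diagonal_diagonal {n : ℕ} (a b : Fin n → ℝ) :
    ⁅Matrix.diagonal a, Matrix.diagonal b⁆ = 0 := by
  ext i j
  rw [lie_diagonal_apply]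
  by_cases hij : i = j <;> simp [hij]

theorem manakov_lax_identity (n : ℕ) (a b : Fin n → ℝ) (ha : Function.Injective a)
    (x : Matrix (Fin n) (Fin n) ℝ) (hx : xᵀ = -x) :
    ⁅Matrix.diagonal a, manakovOmega a b x⁆ = ⁅Matrix.diagonal b, x⁆ ∧
    ∀ lam : ℝ,
      ⁅x + lam • Matrix.diagonal a, manakovOmega a b x + lam • Matrix.diagonal b⁆ =
        ⁅x, manakovOmega a b x⁆ := by
  refine ⟨lie_diagonal_manakovOmega a b ha x, fun lam => ?_⟩
  have h₁ := lie_diagonal_manakovOmega a b ha x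
  have h₂ := lie_diagonal_diagonal a b
  rw [Ring.lie_def, Ring.lie_def] at h₁
  rw [Ring.lie_def] at h₂
  rw [Ring.lie_def, Ring.lie_def]
  simp only [add_mul, mul_add, smul_mul_assoc, mul_smul_comm]
  linear_combination (norm := module) lam • h₁ + (lam * lam) • h₂
end

section
/- Conservation of the 𝔰𝔬(n)_𝐚-component in the singular Manakov flow (equation (5.8)): Let n ∈ ℕ and a, b : Fin n → ℝ satisfy: aᵢ = aⱼ implies bᵢ = bⱼ (i.e. the isotropy algebra of a is contained in that of b). Let x ∈ Mₙ(ℝ) be skew-symmetric and define ω ∈ Mₙ(ℝ) by ω_{ij} = ((bᵢ − bⱼ)/(aᵢ − aⱼ))·x_{ij} if aᵢ ≠ aⱼ, and ω_{ij} = 0 if aᵢ = aⱼ. Then for every pair of indices i, j with aᵢ = aⱼ, the (i,j) entry of the commutator ⁅x, ω⁆ vanishes. Hence along the singular Manakov flow ẋ = ⁅x, ω⁆ the component x_{𝔰𝔬(n)_𝐚} of the angular momentum (the entries x_{ij} with aᵢ = aⱼ) is preserved. -/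
/-!
Conservation of the `𝔰𝔬(n)_𝐚`-component in the singular Manakov flow (5.8):
if `aᵢ = aⱼ → bᵢ = bⱼ`, `x` is skew-symmetric, and
`ω_{ij} = ((bᵢ - bⱼ)/(aᵢ - aⱼ)) x_{ij}` when `aᵢ ≠ aⱼ`, `ω_{ij} = 0` when
`aᵢ = aⱼ`, then the `(i,j)` entry of `⁅x, ω⁆` vanishes whenever `aᵢ = aⱼ`.
-/

open Matrix

/-- The singular Manakov angular velocity `ω = ad_𝐚⁻¹ ∘ ad_𝐛 (x_𝔳)`:
`ω_{ij} = ((bᵢ - bⱼ)/(aᵢ - aⱼ)) x_{ij}` when `aᵢ ≠ aⱼ`, and `ω_{ij} = 0`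
when `aᵢ = aⱼ`. -/
noncomputable def singularManakovOmega {n : ℕ} (a b : Fin n → ℝ)
    (x : Matrix (Fin n) (Fin n) ℝ) : Matrix (Fin n) (Fin n) ℝ :=
  Matrix.of fun i j => if a i = a j then 0 else ((b i - b j) / (a i - a j)) * x i j

theorem singular_manakov_isotropy_preserved (n : ℕ) (a b : Fin n → ℝ)
    (hab : ∀ i j : Fin n, a i = a j → b i = b j)
    (x : Matrix (Fin n) (Fin n) ℝ) (hx : xᵀ = -x) :
    ∀ i j : Fin n, a i = a j → ⁅x, singularManakovOmega a b x⁆ i j = 0 := by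
  intro i j hij
  rw [Ring.lie_def, Matrix.sub_apply, Matrix.mul_apply, Matrix.mul_apply,
    ← Finset.sum_sub_distrib]
  refine Finset.sum_eq_zero fun k _ => ?_
  simp only [singularManakovOmega, Matrix.of_apply, hij, hab i j hij]
  by_cases hk : a k = a j
  · simp [hk]
  · rw [if_neg hk, if_neg (Ne.symm hk), ← neg_sub (b k), ← neg_sub (a k), neg_div_neg_eq]
    ring
end
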